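/- arXiv:2202.00420 — 2 statements merged into one kernel-verified Lean document; each statement's English description precedes it below -/
import Mathlib

section
/- Assume the initialization y₋₁ = y₀, and let ω := 1 − τ_M(L + σ_M‖A‖²). Then for the primal–dual iterates with data b^δ, for every (x, y) ∈ X × Y and every k ≥ 1: ((1 − τ_Mσ_M‖A‖²)/(2τ_M))‖x_k − x‖² + ½‖y_k − y‖_Σ² + ∑_{j=1}^k [L_{b^δ}(x_j, y) − L_{b^δ}(x, y_j)] + (ω/(2τ_M))∑_{j=1}^k ‖x_j − x_{j−1}‖² ≤ V(z₀ − z) + ∑_{j=1}^k ε_j, where z = (x, y) and z₀ = (x₀, y₀). -/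
open scoped RealInnerProductSpace ENNReal NNReal
open Filter Topology

noncomputable section

/-- The `ε`-subdifferential of an extended-real-valued function `R` at `x`:
`∂_ε R (x) = {u : ∀ x', R x - R x' ≤ ⟪u, x - x'⟫ + ε}`, written without `EReal` subtraction. -/
def epsSubdiff {X : Type*} [NormedAddCommGroup X] [InnerProductSpace ℝ X]
    (R : X → EReal) (ε : ℝ) (x : X) : Set X :=
  {u | ∀ x' : X, R x + ((⟪u, x' - x⟫ - ε : ℝ) : EReal) ≤ R x'}

/-- Convexity for extended-real-valued functions. -/
def ERealConvex {X : Type*} [AddCommGroup X] [Module ℝ X] (R : X → EReal) : Prop :=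
  ∀ x y : X, ∀ t : ℝ, 0 ≤ t → t ≤ 1 →
    R (t • x + (1 - t) • y) ≤ (t : EReal) * R x + ((1 - t : ℝ) : EReal) * R y

/-- `R` is proper, convex and lower semicontinuous. -/
def ProperConvexLsc {X : Type*} [NormedAddCommGroup X] [InnerProductSpace ℝ X]
    (R : X → EReal) : Prop :=
  (∃ x, R x ≠ ⊤) ∧ (∀ x, R x ≠ ⊥) ∧ ERealConvex R ∧ LowerSemicontinuous R

/-- The Lagrangian `L_b(x,y) = R x + F x + ⟪y, A x - b⟫`. -/
def Lag {X Y : Type*} [NormedAddCommGroup X] [InnerProductSpace ℝ X]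
    [NormedAddCommGroup Y] [InnerProductSpace ℝ Y]
    (R : X → EReal) (F : X → ℝ) (A : X →L[ℝ] Y) (b : Y) (x : X) (y : Y) : EReal :=
  R x + ((F x + ⟪y, A x - b⟫ : ℝ) : EReal)

/-- Saddle points of the Lagrangian `L_b`. -/
def IsSaddle {X Y : Type*} [NormedAddCommGroup X] [InnerProductSpace ℝ X]
    [NormedAddCommGroup Y] [InnerProductSpace ℝ Y]
    (R : X → EReal) (F : X → ℝ) (A : X →L[ℝ] Y) (b : Y) (p : X × Y) : Prop :=
  ∀ x : X, ∀ y : Y, Lag R F A b p.1 y ≤ Lag R F A b x p.2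

/-- Weak convergence of a sequence in a Hilbert space. -/
def WeakTendsto {X : Type*} [NormedAddCommGroup X] [InnerProductSpace ℝ X]
    (u : ℕ → X) (l : X) : Prop :=
  ∀ w : X, Tendsto (fun k => ⟪u k, w⟫) atTop (nhds ⟪l, w⟫)

/-- `V(x,y) = ½‖x‖_T² + ½‖y‖_Σ²`, written via the inverses of the preconditioners. -/
def Vfun {X Y : Type*} [NormedAddCommGroup X] [InnerProductSpace ℝ X]
    [NormedAddCommGroup Y] [InnerProductSpace ℝ Y]
    (Tinv : X →L[ℝ] X) (Sginv : Y →L[ℝ] Y) (z : X × Y) : ℝ :=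
  1 / 2 * ⟪Tinv z.1, z.1⟫ + 1 / 2 * ⟪Sginv z.2, z.2⟫

variable {X Y : Type*}
  [NormedAddCommGroup X] [InnerProductSpace ℝ X] [CompleteSpace X]
  [NormedAddCommGroup Y] [InnerProductSpace ℝ Y] [CompleteSpace Y]

theorem hasDerivAt_comp_line {X : Type*} [NormedAddCommGroup X] [InnerProductSpace ℝ X]
    [CompleteSpace X] {F : X → ℝ} {F' : X → X} (hF : ∀ u : X, HasGradientAt F (F' u) u)
    (a v : X) (t : ℝ) : HasDerivAt (fun s : ℝ => F (a + s • v)) ⟪F' (a + t • v), v⟫ t := by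
  have h1 : HasDerivAt (fun s : ℝ => a + s • v) v t := by
    simpa using ((hasDerivAt_id t).smul_const v).const_add a
  simpa [Function.comp_def] using
    (hF (a + t • v)).hasFDerivAt.comp_hasDerivAt t h1

/-- The gradient inequality for a convex function. -/
theorem ConvexOn.add_inner_gradient_le {X : Type*} [NormedAddCommGroup X]
    [InnerProductSpace ℝ X] [CompleteSpace X] {F : X → ℝ} {F' : X → X}
    (hconv : ConvexOn ℝ Set.univ F) (hF : ∀ u : X, HasGradientAt F (F' u) u) (a b : X) :
    F a + ⟪F' a, b - a⟫ ≤ F b := by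
  have hc : ConvexOn ℝ Set.univ (fun s : ℝ => F (a + s • (b - a))) := by
    have := hconv.comp_affineMap (AffineMap.lineMap (k := ℝ) a b)
    simpa [Function.comp_def, AffineMap.lineMap_apply, add_comm] using this
  have hd := hasDerivAt_comp_line hF a (b - a) 0
  have := hc.le_slope_of_hasDerivAt (Set.mem_univ 0) (Set.mem_univ 1) zero_lt_one hd
  simp only [slope_def_field, zero_smul, one_smul, add_zero, add_sub_cancel, sub_zero,
    div_one] at this
  linarith

/-- The descent lemma for a function with Lipschitz gradient. -/
theorem le_add_inner_gradient_add_sq {X : Type*} [NormedAddCommGroup X]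
    [InnerProductSpace ℝ X] [CompleteSpace X] {F : X → ℝ} {F' : X → X} {L : ℝ}
    (hF : ∀ u : X, HasGradientAt F (F' u) u)
    (hlip : ∀ u v : X, ‖F' u - F' v‖ ≤ L * ‖u - v‖) (a b : X) :
    F b ≤ F a + ⟪F' a, b - a⟫ + L / 2 * ‖b - a‖ ^ 2 := by
  set v := b - a with hv
  let g : ℝ → ℝ := fun s => F (a + s • v) - s * ⟪F' a, v⟫ - s ^ 2 * (L / 2 * ‖v‖ ^ 2)
  have hg : ∀ t, HasDerivAt g
      (⟪F' (a + t • v), v⟫ - ⟪F' a, v⟫ - 2 * t * (L / 2 * ‖v‖ ^ 2)) t := fun t => by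
    refine HasDerivAt.congr_deriv (((hasDerivAt_comp_line hF a v t).sub
      ((hasDerivAt_id t).mul_const ⟪F' a, v⟫)).sub
      ((hasDerivAt_pow 2 t).mul_const (L / 2 * ‖v‖ ^ 2))) ?_
    simp
  have hanti : AntitoneOn g (Set.Icc 0 1) := by
    refine antitoneOn_of_deriv_nonpos (convex_Icc 0 1)
      (fun t _ => (hg t).continuousAt.continuousWithinAt)
      (fun t _ => (hg t).differentiableAt.differentiableWithinAt) fun t ht => ?_
    rw [interior_Icc] at ht
    rw [(hg t).deriv, ← inner_sub_left]
    have h1 := real_inner_le_norm (F' (a + t • v) - F' a) v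
    have h2 := hlip (a + t • v) a
    rw [add_sub_cancel_left, norm_smul, Real.norm_eq_abs, abs_of_pos ht.1] at h2
    have h3 := mul_le_mul_of_nonneg_right h2 (norm_nonneg v)
    nlinarith
  have h := hanti (Set.left_mem_Icc.2 zero_le_one) (Set.right_mem_Icc.2 zero_le_one) zero_le_one
  simp only [g, zero_smul, one_smul, add_zero, zero_mul, one_mul, one_pow, sub_zero, ne_eq,
    OfNat.ofNat_ne_zero, not_false_eq_true, zero_pow] at h
  rw [hv, add_sub_cancel, ← hv] at h
  linarith

/-- The right inverse of a symmetric map is symmetric. -/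
theorem inner_rightInverse_symm {E : Type*} [NormedAddCommGroup E] [InnerProductSpace ℝ E]
    {S Sinv : E →L[ℝ] E} (hinv : ∀ u, S (Sinv u) = u)
    (hsa : ∀ u v : E, ⟪S u, v⟫ = ⟪u, S v⟫) (u v : E) : ⟪Sinv u, v⟫ = ⟪u, Sinv v⟫ := by
  conv_lhs => rw [← hinv v]
  rw [← hsa, hinv]

theorem inner_symm_three_point {E : Type*} [NormedAddCommGroup E] [InnerProductSpace ℝ E]
    {P : E →L[ℝ] E} (hP : ∀ u v : E, ⟪P u, v⟫ = ⟪u, P v⟫) (a b c : E) :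
    ⟪P (a - b), a - c⟫ = 1 / 2 * ⟪P (a - c), a - c⟫ + 1 / 2 * ⟪P (a - b), a - b⟫
      - 1 / 2 * ⟪P (b - c), b - c⟫ := by
  have h1 : ⟪P a, b⟫ = ⟪P b, a⟫ := by rw [hP, real_inner_comm]
  have h2 : ⟪P a, c⟫ = ⟪P c, a⟫ := by rw [hP, real_inner_comm]
  have h3 : ⟪P b, c⟫ = ⟪P c, b⟫ := by rw [hP, real_inner_comm]
  simp only [map_sub, inner_sub_left, inner_sub_right]
  linarith

/-- Young's inequality for the norm induced by the inverse of a bounded positive map. -/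
theorem inner_le_half_inner_inverse_add {E : Type*} [NormedAddCommGroup E]
    [InnerProductSpace ℝ E] {S Sinv : E →L[ℝ] E} {M : ℝ} (hinv : ∀ u, S (Sinv u) = u)
    (hsa : ∀ u v : E, ⟪S u, v⟫ = ⟪u, S v⟫)
    (hpos : ∀ u : E, 0 ≤ ⟪S u, u⟫) (hM : ∀ u : E, ⟪S u, u⟫ ≤ M * ‖u‖ ^ 2) (u w : E) :
    ⟪u, w⟫ ≤ 1 / 2 * ⟪Sinv u, u⟫ + M / 2 * ‖w‖ ^ 2 := by
  have h := hpos (Sinv u - w)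
  have h1 : ⟪S w, Sinv u⟫ = ⟪u, w⟫ := by rw [hsa, hinv, real_inner_comm]
  simp only [map_sub, hinv, inner_sub_left, inner_sub_right, h1] at h
  have h2 := hM w
  linarith [real_inner_comm (Sinv u) u]

theorem norm_sq_div_le_inner_inverse {E : Type*} [NormedAddCommGroup E]
    [InnerProductSpace ℝ E] {S Sinv : E →L[ℝ] E} {M : ℝ} (hM0 : 0 < M)
    (hinv : ∀ u, S (Sinv u) = u) (hsa : ∀ u v : E, ⟪S u, v⟫ = ⟪u, S v⟫)
    (hpos : ∀ u : E, 0 ≤ ⟪S u, u⟫) (hM : ∀ u : E, ⟪S u, u⟫ ≤ M * ‖u‖ ^ 2) (u : E) :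
    ‖u‖ ^ 2 / M ≤ ⟪Sinv u, u⟫ := by
  have h := inner_le_half_inner_inverse_add hinv hsa hpos hM u (M⁻¹ • u)
  rw [inner_smul_right, real_inner_self_eq_norm_sq, norm_smul, mul_pow, Real.norm_eq_abs,
    sq_abs] at h
  have e : M / 2 * (M⁻¹ ^ 2 * ‖u‖ ^ 2) = 1 / 2 * (‖u‖ ^ 2 / M) := by field_simp
  rw [e, inv_mul_eq_div] at h
  linarith

theorem inner_map_le_half_inner_inverse_add {X Y : Type*}
    [NormedAddCommGroup X] [InnerProductSpace ℝ X] [NormedAddCommGroup Y]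
    [InnerProductSpace ℝ Y] (A : X →L[ℝ] Y) {S Sinv : Y →L[ℝ] Y} {M : ℝ} (hM0 : 0 ≤ M)
    (hinv : ∀ u, S (Sinv u) = u) (hsa : ∀ u v : Y, ⟪S u, v⟫ = ⟪u, S v⟫)
    (hpos : ∀ u : Y, 0 ≤ ⟪S u, u⟫) (hM : ∀ u : Y, ⟪S u, u⟫ ≤ M * ‖u‖ ^ 2) (u : Y) (w : X) :
    ⟪u, A w⟫ ≤ 1 / 2 * ⟪Sinv u, u⟫ + M * ‖A‖ ^ 2 / 2 * ‖w‖ ^ 2 := by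
  have h := inner_le_half_inner_inverse_add hinv hsa hpos hM u (A w)
  have h1 : ‖A w‖ ^ 2 ≤ ‖A‖ ^ 2 * ‖w‖ ^ 2 := by
    rw [← mul_pow]
    exact pow_le_pow_left₀ (norm_nonneg _) (A.le_opNorm w) 2
  have h2 := mul_le_mul_of_nonneg_left h1 (by positivity : 0 ≤ M / 2)
  linarith

theorem EReal.sum_coe {ι : Type*} (s : Finset ι) (f : ι → ℝ) :
    ∑ i ∈ s, (f i : EReal) = ((∑ i ∈ s, f i : ℝ) : EReal) :=
  (map_sum (⟨⟨(↑), EReal.coe_zero⟩, EReal.coe_add⟩ : ℝ →+ EReal) f s).symm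

/-- First cumulative estimate (with initialization `y₋₁ = y₀` and
`ω = 1 - τ_M (L + σ_M‖A‖²)`): for all `(x, y)` and `k ≥ 1`,
`((1 - τ_M σ_M‖A‖²)/(2τ_M))‖x_k - x‖² + ½‖y_k - y‖_Σ² + Σ_{j=1}^k [L_{b^δ}(x_j,y) - L_{b^δ}(x,y_j)]
 + (ω/(2τ_M)) Σ_{j=1}^k ‖x_j - x_{j-1}‖² ≤ V(z₀ - z) + Σ_{j=1}^k ε_j`
(with the `EReal` Lagrangian sums kept on each side of the inequality). -/
theorem statement_13
    (A : X →L[ℝ] Y) (bδ : Y)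
    (R : X → EReal) (hR : ProperConvexLsc R)
    (F : X → ℝ) (F' : X → X) (L : ℝ) (hL : 0 ≤ L)
    (hFconv : ConvexOn ℝ Set.univ F)
    (hFgrad : ∀ u : X, HasGradientAt F (F' u) u)
    (hFlip : ∀ u v : X, ‖F' u - F' v‖ ≤ L * ‖u - v‖)
    (T Tinv : X →L[ℝ] X) (Sg Sginv : Y →L[ℝ] Y)
    (hTinv : ∀ u, Tinv (T u) = u) (hTinv' : ∀ u, T (Tinv u) = u)
    (hSginv : ∀ v, Sginv (Sg v) = v) (hSginv' : ∀ v, Sg (Sginv v) = v)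
    (hTsa : ∀ u v : X, ⟪T u, v⟫ = ⟪u, T v⟫)
    (hSgsa : ∀ u v : Y, ⟪Sg u, v⟫ = ⟪u, Sg v⟫)
    (τm τM σm σM : ℝ) (hτm : 0 < τm) (hττ : τm ≤ τM) (hσm : 0 < σm) (hσσ : σm ≤ σM)
    (hTb : ∀ u : X, τm * ‖u‖ ^ 2 ≤ ⟪T u, u⟫ ∧ ⟪T u, u⟫ ≤ τM * ‖u‖ ^ 2)
    (hSgb : ∀ v : Y, σm * ‖v‖ ^ 2 ≤ ⟪Sg v, v⟫ ∧ ⟪Sg v, v⟫ ≤ σM * ‖v‖ ^ 2)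
    (ε : ℕ → ℝ) (hε : ∀ k, 0 ≤ ε k)
    (x : ℕ → X) (y : ℕ → Y) (ym1 : Y) (hinit : ym1 = y 0)
    (hstep : ∀ k : ℕ,
      -(Tinv (x (k + 1) - x k)) - F' (x k)
          - ContinuousLinearMap.adjoint A ((2 : ℝ) • y k - (if k = 0 then ym1 else y (k - 1)))
        ∈ epsSubdiff R (ε (k + 1)) (x (k + 1)))
    (hdual : ∀ k : ℕ, y (k + 1) = y k + Sg (A (x (k + 1)) - bδ)) :
    ∀ px : X, ∀ py : Y, ∀ k : ℕ, 1 ≤ k →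
      (((1 - τM * σM * ‖A‖ ^ 2) / (2 * τM) * ‖x k - px‖ ^ 2
          + 1 / 2 * ⟪Sginv (y k - py), y k - py⟫
          + (1 - τM * (L + σM * ‖A‖ ^ 2)) / (2 * τM)
              * ∑ j ∈ Finset.Icc 1 k, ‖x j - x (j - 1)‖ ^ 2 : ℝ) : EReal)
          + ∑ j ∈ Finset.Icc 1 k, Lag R F A bδ (x j) py
        ≤ ((Vfun Tinv Sginv (x 0 - px, y 0 - py) + ∑ j ∈ Finset.Icc 1 k, ε j : ℝ) : EReal)
          + ∑ j ∈ Finset.Icc 1 k, Lag R F A bδ px (y j) := by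
  intro px py k hk
  have hτM : 0 < τM := hτm.trans_le hττ
  have hσM : 0 < σM := hσm.trans_le hσσ
  have hTpos : ∀ u : X, 0 ≤ ⟪T u, u⟫ := fun u => le_trans (by positivity) (hTb u).1
  have hSgpos : ∀ v : Y, 0 ≤ ⟪Sg v, v⟫ := fun v => le_trans (by positivity) (hSgb v).1
  have hTsym := inner_rightInverse_symm hTinv' hTsa
  have hSgsym := inner_rightInverse_symm hSginv' hSgsa
  have hTlow := norm_sq_div_le_inner_inverse hτM hTinv' hTsa hTpos fun u => (hTb u).2
  have hyoung := inner_map_le_half_inner_inverse_add A hσM.le hSginv' hSgsa hSgpos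
    fun v => (hSgb v).2
  by_cases htop : R px = ⊤
  · have hsum : ∑ j ∈ Finset.Icc 1 k, Lag R F A bδ px (y j) = ⊤ := by
      simp only [Lag, htop, EReal.top_add_coe]
      induction k, hk using Nat.le_induction with
      | base => simp
      | succ n hn ih => rw [Finset.sum_Icc_succ_top (by omega), ih, EReal.top_add_top]
    rw [hsum, EReal.coe_add_top]
    exact le_top
  have hbot := hR.2.1
  obtain ⟨rp, hrp⟩ : ∃ r : ℝ, R px = r := ⟨_, (EReal.coe_toReal htop (hbot px)).symm⟩
  have hfin : ∀ j, ∃ r : ℝ, R (x (j + 1)) = r := fun j => by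
    have h := hstep j px
    have hne : R (x (j + 1)) ≠ ⊤ := by
      intro h'
      rw [h', EReal.top_add_coe, hrp] at h
      exact absurd h (by simp)
    exact ⟨_, (EReal.coe_toReal hne (hbot _)).symm⟩
  choose r hr using hfin
  let a : ℕ → ℝ := fun j => r (j - 1) + (F (x j) + ⟪py, A (x j) - bδ⟫)
  let c : ℕ → ℝ := fun j => rp + (F px + ⟪y j, A px - bδ⟫)
  have hstep_le : ∀ j : ℕ,
      a (j + 1) - c (j + 1)
        + 1 / 2 * ⟪Tinv (x (j + 1) - px), x (j + 1) - px⟫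
        + 1 / 2 * ⟪Sginv (y (j + 1) - py), y (j + 1) - py⟫
        + 1 / 2 * ⟪Sginv (y (j + 1) - y j), y (j + 1) - y j⟫
        - ⟪y (j + 1) - y j, A (x (j + 1) - px)⟫
        + (1 - τM * (L + σM * ‖A‖ ^ 2)) / (2 * τM) * ‖x (j + 1) - x j‖ ^ 2
      ≤ 1 / 2 * ⟪Tinv (x j - px), x j - px⟫
        + 1 / 2 * ⟪Sginv (y j - py), y j - py⟫
        + 1 / 2 * ⟪Sginv (y j - y (j - 1)), y j - y (j - 1)⟫
        - ⟪y j - y (j - 1), A (x j - px)⟫ + ε (j + 1) := fun j => by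
    have hprev : (if j = 0 then ym1 else y (j - 1)) = y (j - 1) := by
      split_ifs with h0
      · rw [h0, hinit]
      · rfl
    have h := hstep j px
    rw [hprev, hr, hrp, ← EReal.coe_add, EReal.coe_le_coe_iff, inner_sub_left, inner_sub_left,
      inner_neg_left, ContinuousLinearMap.adjoint_inner_left] at h
    have hconv := hFconv.add_inner_gradient_le hFgrad (x j) px
    have hdesc := le_add_inner_gradient_add_sq hFgrad hFlip (x j) (x (j + 1))
    have hT3 := inner_symm_three_point hTsym (x (j + 1)) (x j) px
    have hS3 := inner_symm_three_point hSgsym (y (j + 1)) (y j) py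
    have hlow := hTlow (x (j + 1) - x j)
    have hy := hyoung (y j - y (j - 1)) (x j - x (j + 1))
    have hres : Sginv (y (j + 1) - y j) = A (x (j + 1)) - bδ := by
      rw [hdual j, add_sub_cancel_left, hSginv]
    rw [norm_sub_rev] at hy
    have hω : (1 - τM * (L + σM * ‖A‖ ^ 2)) / (2 * τM) * ‖x (j + 1) - x j‖ ^ 2
        = 1 / 2 * (‖x (j + 1) - x j‖ ^ 2 / τM) - L / 2 * ‖x (j + 1) - x j‖ ^ 2
          - σM * ‖A‖ ^ 2 / 2 * ‖x (j + 1) - x j‖ ^ 2 := by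
      field_simp
      ring
    have hflip : ⟪Tinv (x (j + 1) - x j), px - x (j + 1)⟫
        = -⟪Tinv (x (j + 1) - x j), x (j + 1) - px⟫ := by rw [← inner_neg_right, neg_sub]
    have hS3' : ⟪Sginv (y (j + 1) - y j), y (j + 1) - py⟫
        = ⟪y (j + 1), A (x (j + 1))⟫ - ⟪y (j + 1), bδ⟫
          - (⟪py, A (x (j + 1))⟫ - ⟪py, bδ⟫) := by
      rw [hres, real_inner_comm, inner_sub_left, inner_sub_right, inner_sub_right]
    rw [hω]
    simp only [a, c, add_tsub_cancel_right]
    rw [hflip, hT3] at h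
    rw [hS3] at hS3'
    generalize ⟪Tinv (x (j + 1) - px), x (j + 1) - px⟫ = t₁ at h ⊢
    generalize ⟪Tinv (x (j + 1) - x j), x (j + 1) - x j⟫ = t₂ at h hlow ⊢
    generalize ⟪Tinv (x j - px), x j - px⟫ = t₃ at h ⊢
    generalize ⟪Sginv (y (j + 1) - py), y (j + 1) - py⟫ = s₁ at hS3' ⊢
    generalize ⟪Sginv (y (j + 1) - y j), y (j + 1) - y j⟫ = s₂ at hS3' ⊢
    generalize ⟪Sginv (y j - py), y j - py⟫ = s₃ at hS3' ⊢
    generalize ⟪Sginv (y j - y (j - 1)), y j - y (j - 1)⟫ = s₄ at hy ⊢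
    simp only [map_sub, inner_sub_left, inner_sub_right, real_inner_smul_left]
      at h hconv hdesc hy ⊢
    linarith
  have hsum_le : ∀ n : ℕ,
      ∑ j ∈ Finset.Icc 1 n, a j
        + 1 / 2 * ⟪Tinv (x n - px), x n - px⟫
        + 1 / 2 * ⟪Sginv (y n - py), y n - py⟫
        + 1 / 2 * ⟪Sginv (y n - y (n - 1)), y n - y (n - 1)⟫
        - ⟪y n - y (n - 1), A (x n - px)⟫
        + (1 - τM * (L + σM * ‖A‖ ^ 2)) / (2 * τM)
            * ∑ j ∈ Finset.Icc 1 n, ‖x j - x (j - 1)‖ ^ 2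
      ≤ Vfun Tinv Sginv (x 0 - px, y 0 - py) + ∑ j ∈ Finset.Icc 1 n, ε j
        + ∑ j ∈ Finset.Icc 1 n, c j := fun n => by
    induction n with
    | zero => simp [Vfun]
    | succ n ih =>
      have h := hstep_le n
      simp only [Finset.sum_Icc_succ_top (Nat.le_add_left 1 n), add_tsub_cancel_right]
      rw [mul_add ((1 - τM * (L + σM * ‖A‖ ^ 2)) / (2 * τM))]
      linarith
  have hlag : ∑ j ∈ Finset.Icc 1 k, Lag R F A bδ (x j) py
      = ((∑ j ∈ Finset.Icc 1 k, a j : ℝ) : EReal) := by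
    rw [← EReal.sum_coe]
    refine Finset.sum_congr rfl fun j hj => ?_
    obtain ⟨i, rfl⟩ := Nat.exists_eq_add_of_le' (Finset.mem_Icc.1 hj).1
    simp only [Lag, a, hr, add_tsub_cancel_right, ← EReal.coe_add]
  have hlag' : ∑ j ∈ Finset.Icc 1 k, Lag R F A bδ px (y j)
      = ((∑ j ∈ Finset.Icc 1 k, c j : ℝ) : EReal) := by
    rw [← EReal.sum_coe]
    exact Finset.sum_congr rfl fun j _ => by simp only [Lag, c, hrp, ← EReal.coe_add]
  rw [hlag, hlag', ← EReal.coe_add, ← EReal.coe_add, EReal.coe_le_coe_iff]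
  have h := hsum_le k
  have hlow := hTlow (x k - px)
  have hy := hyoung (y k - y (k - 1)) (x k - px)
  have hcoef : (1 - τM * σM * ‖A‖ ^ 2) / (2 * τM) * ‖x k - px‖ ^ 2
      = 1 / 2 * (‖x k - px‖ ^ 2 / τM) - σM * ‖A‖ ^ 2 / 2 * ‖x k - px‖ ^ 2 := by
    field_simp
  rw [hcoef]
  linarith
end
end

section
/- Let X and Y be real Hilbert spaces, A : X → Y a bounded linear operator with adjoint A*, b*, b^δ ∈ Y, and S := (A*A)^{1/2} the positive square root of A*A. If x̃, x^δ ∈ X satisfy A*Ax̃ = A*b* and A*Ax^δ = A*b^δ, then ‖Sx^δ − Sx̃‖ ≤ ‖b^δ − b*‖. -/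
open scoped RealInnerProductSpace ENNReal NNReal
open Filter Topology

noncomputable section

variable {X Y : Type*}
  [NormedAddCommGroup X] [InnerProductSpace ℝ X] [CompleteSpace X]
  [NormedAddCommGroup Y] [InnerProductSpace ℝ Y] [CompleteSpace Y]

open ContinuousLinearMap in
/-- A symmetric square root of `A*A` has the same norm as `A` at every vector. -/
lemma norm_eq_norm_of_symmetric_sqrt (A : X →L[ℝ] Y) (S : X →L[ℝ] X)
    (hSsa : ∀ u v : X, ⟪S u, v⟫ = ⟪u, S v⟫) (hSsq : ∀ u : X, S (S u) = adjoint A (A u)) (u : X) :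
    ‖S u‖ = ‖A u‖ := by
  rw [← sq_eq_sq₀ (norm_nonneg _) (norm_nonneg _), ← real_inner_self_eq_norm_sq,
    ← real_inner_self_eq_norm_sq, hSsa, hSsq, adjoint_inner_right]

open ContinuousLinearMap in
/-- The image of a solution of the normal equation is no longer than the data. -/
lemma norm_map_le_of_normal_equation (A : X →L[ℝ] Y) {u : X} {b : Y}
    (h : adjoint A (A u) = adjoint A b) : ‖A u‖ ≤ ‖b‖ := by
  have key : ‖A u‖ * ‖A u‖ ≤ ‖A u‖ * ‖b‖ := by
    rw [← real_inner_self_eq_norm_mul_norm, ← adjoint_inner_right, h, adjoint_inner_right]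
    exact real_inner_le_norm _ _
  rcases (norm_nonneg (A u)).eq_or_lt with h0 | h0
  · exact h0 ▸ norm_nonneg b
  · exact le_of_mul_le_mul_left key h0

/-- If `S` is the positive self-adjoint square root of `A*A` and
`A*A x̃ = A* b*`, `A*A x^δ = A* b^δ`, then `‖S x^δ - S x̃‖ ≤ ‖b^δ - b*‖`. -/
theorem statement_18
    (A : X →L[ℝ] Y) (bstar bδ : Y)
    (S : X →L[ℝ] X)
    (hSsa : ∀ u v : X, ⟪S u, v⟫ = ⟪u, S v⟫)
    (hSpos : ∀ u : X, 0 ≤ ⟪S u, u⟫)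
    (hSsq : ∀ u : X, S (S u) = ContinuousLinearMap.adjoint A (A u))
    (xtil xδ : X)
    (hxtil : ContinuousLinearMap.adjoint A (A xtil) = ContinuousLinearMap.adjoint A bstar)
    (hxδ : ContinuousLinearMap.adjoint A (A xδ) = ContinuousLinearMap.adjoint A bδ) :
    ‖S xδ - S xtil‖ ≤ ‖bδ - bstar‖ := by
  rw [← map_sub, norm_eq_norm_of_symmetric_sqrt A S hSsa hSsq]
  exact norm_map_le_of_normal_equation A (by simp only [map_sub, hxtil, hxδ])
end
end
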